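/- Let S be a shuffler over a finite alphabet A with |A| ≥ 2, let n and r be positive integers, let ε be a real with 6/⌊n/r⌋ ≤ ε ≤ 1/|A|^r, and let γ ∈ A^r. Then (μ×μ)(E_S(ε,γ,n)) > 1 − 2·|A|^{2r−2}·r·e^{−|A|^r ε² n/(6r)}. -/

import Mathlib

open Filter Topology

namespace FSI

variable {A B D Q : Type*}

/-- The prefix of length `n` of the infinite word `x`. -/
def pref (x : ℕ → A) (n : ℕ) : List A := (List.range n).map x

/-- Number of (possibly overlapping) occurrences of `u` in `w`. -/
noncomputable def occ (w u : List A) : ℕ :=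
  Nat.card {i : ℕ | i + u.length ≤ w.length ∧ (w.drop i).take u.length = u}

/-- Number of aligned occurrences of `u` in `w`. -/
noncomputable def alocc (w u : List A) : ℕ :=
  Nat.card {i : ℕ | i + u.length ≤ w.length ∧ i % u.length = 0 ∧ (w.drop i).take u.length = u}

/-- `x` is simply normal to word length `ℓ`. -/
def SimplyNormalTo [Fintype A] (x : ℕ → A) (ℓ : ℕ) : Prop :=
  ∀ u : List A, u.length = ℓ →
    Tendsto (fun n : ℕ => (alocc (pref x (n * ℓ)) u : ℝ) / n) atTop
      (nhds ((Fintype.card A : ℝ)⁻¹ ^ ℓ))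

/-- `x` is a normal infinite word. -/
def Normal [Fintype A] (x : ℕ → A) : Prop := ∀ ℓ : ℕ, 1 ≤ ℓ → SimplyNormalTo x ℓ

/-! ### Two-tape automata -/

/-- A `2`-automaton with input alphabets `A`, `B` and state set `Q`;
`none` plays the role of the empty word `ε` in transition labels. -/
structure TwoAut (A B Q : Type*) where
  init : Set Q
  trans : Set (Q × (Option A × Option B) × Q)

/-- The support of a label. -/
def lsupp (l : Option A × Option B) : Bool × Bool := (l.1.isSome, l.2.isSome)

/-- A `2`-deterministic `2`-automaton. -/
def TwoAut.TwoDet (M : TwoAut A B Q) : Prop :=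
  (∃ q₀, M.init = {q₀}) ∧
  ∀ t ∈ M.trans, ∀ t' ∈ M.trans, t.1 = t'.1 →
    lsupp t.2.1 = lsupp t'.2.1 ∧ (t.2.1 = t'.2.1 → t = t')

/-- A `1`-deterministic `2`-automaton. -/
def TwoAut.OneDet (M : TwoAut A B Q) : Prop :=
  (∃ q₀, M.init = {q₀}) ∧
  ∀ t ∈ M.trans, ∀ t' ∈ M.trans, t.1 = t'.1 →
    t.2.1.1.isSome = t'.2.1.1.isSome ∧ (t.2.1.1 = t'.2.1.1 → t = t')

/-- `2`-completeness. -/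
def TwoAut.TwoComplete (M : TwoAut A B Q) : Prop :=
  ∀ (q : Q) (l l' : Option A × Option B),
    (∃ q', (q, l, q') ∈ M.trans) → lsupp l' = lsupp l → ∃ q', (q, l', q') ∈ M.trans

/-- Every transition reads exactly one symbol. -/
def TwoAut.OneSymbol (M : TwoAut A B Q) : Prop :=
  ∀ t ∈ M.trans, lsupp t.2.1 = (true, false) ∨ lsupp t.2.1 = (false, true)

def TwoAut.Step (M : TwoAut A B Q) (p q : Q) : Prop := ∃ l, (p, l, q) ∈ M.trans

/-- There is a finite run from `p` to `q`. -/
def TwoAut.Reaches (M : TwoAut A B Q) : Q → Q → Prop := Relation.ReflTransGen M.Step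

def TwoAut.StronglyConnected (M : TwoAut A B Q) : Prop := ∀ p q, M.Reaches p q

/-- Word read on the first tape by the first `n` transitions of `γ`. -/
def in1 (γ : ℕ → Q × (Option A × Option B) × Q) (n : ℕ) : List A :=
  ((List.range n).map fun i => (γ i).2.1.1).reduceOption

/-- Word read on the second tape by the first `n` transitions of `γ`. -/
def in2 (γ : ℕ → Q × (Option A × Option B) × Q) (n : ℕ) : List B :=
  ((List.range n).map fun i => (γ i).2.1.2).reduceOption

/-- `γ` is an infinite run of `M` (not necessarily from the initial state) whose
two input labels are the infinite words `x` and `y`. -/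
def TwoAut.IsRunOn (M : TwoAut A B Q) (γ : ℕ → Q × (Option A × Option B) × Q)
    (x : ℕ → A) (y : ℕ → B) : Prop :=
  (∀ n, γ n ∈ M.trans) ∧ (∀ n, (γ n).2.2 = (γ (n + 1)).1) ∧
  (∀ n, in1 γ n = pref x (in1 γ n).length) ∧ (∀ n, in2 γ n = pref y (in2 γ n).length) ∧
  Tendsto (fun n => (in1 γ n).length) atTop atTop ∧
  Tendsto (fun n => (in2 γ n).length) atTop atTop

/-- The pair `(x, y)` is accepted by `M`. -/
def TwoAut.Accepts (M : TwoAut A B Q) (x : ℕ → A) (y : ℕ → B) : Prop :=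
  ∃ γ, (γ 0).1 ∈ M.init ∧ M.IsRunOn γ x y

/-- Number of occurrences of the state `q` among the first `n` transitions of `γ`. -/
noncomputable def stateCount (γ : ℕ → Q × (Option A × Option B) × Q) (q : Q) (n : ℕ) : ℕ :=
  Nat.card {i : ℕ | i < n ∧ (γ i).1 = q}

/-- Number of occurrences of the transition `τ` among the first `n` transitions of `γ`. -/
noncomputable def transCount (γ : ℕ → Q × (Option A × Option B) × Q)
    (τ : Q × (Option A × Option B) × Q) (n : ℕ) : ℕ :=
  Nat.card {i : ℕ | i < n ∧ γ i = τ}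

/-! ### Markov chain associated with a one-symbol automaton -/

/-- The `(p,q)` entry of the Markov matrix associated with the transition set `T`. -/
noncomputable def markovOf {S : Type*} [Fintype A] [Fintype B]
    (T : Set (S × (Option A × Option B) × S)) (p q : S) : ℝ :=
  (Nat.card {a : A | (p, (some a, none), q) ∈ T} : ℝ) / (Fintype.card A : ℝ) +
  (Nat.card {b : B | (p, (none, some b), q) ∈ T} : ℝ) / (Fintype.card B : ℝ)

/-- `π` is a stationary distribution for the transition set `T` restricted to the
finite state set `st`. -/
def IsStationaryOn {S : Type*} [Fintype A] [Fintype B]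
    (T : Set (S × (Option A × Option B) × S)) (st : Finset S) (π : S → ℝ) : Prop :=
  (∀ s ∈ st, 0 ≤ π s) ∧ (∑ s ∈ st, π s = 1) ∧
  ∀ q ∈ st, (∑ p ∈ st, π p * markovOf T p q) = π q

/-- `π` is a stationary distribution of the Markov chain associated with `M`. -/
def TwoAut.IsStationary [Fintype A] [Fintype B] [Fintype Q]
    (M : TwoAut A B Q) (π : Q → ℝ) : Prop :=
  IsStationaryOn M.trans Finset.univ π

/-- The frequency property for the pair `(x, y)`: in every strongly connected
`2`-deterministic `2`-automaton (reading one symbol per transition), every infinite run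
on a suffix of `x` and a suffix of `y` visits each state with frequency given by the
stationary distribution, and the automaton is `2`-complete. -/
def FreqProp [Fintype A] [Fintype B] (x : ℕ → A) (y : ℕ → B) : Prop :=
  ∀ (Q' : Type) [Fintype Q'] (M : TwoAut A B Q'), M.TwoDet → M.OneSymbol →
    M.StronglyConnected →
    ∀ (i j : ℕ) (γ : ℕ → Q' × (Option A × Option B) × Q'),
      M.IsRunOn γ (fun n => x (n + i)) (fun n => y (n + j)) →
      M.TwoComplete ∧
      ∃ π : Q' → ℝ, M.IsStationary π ∧
        ∀ q, Tendsto (fun n : ℕ => (stateCount γ q n : ℝ) / n) atTop (nhds (π q))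

/-! ### Conditional compressors (2-deterministic 3-automata) -/

/-- A `3`-automaton with two input tapes (alphabets `A` and `B`) and one
output tape (alphabet `D`), with a single initial state. -/
structure Comp3 (A B D Q : Type*) where
  init : Q
  trans : Set (Q × (Option A × Option B) × List D × Q)

/-- `2`-determinism for `3`-automata. -/
def Comp3.TwoDet (C : Comp3 A B D Q) : Prop :=
  ∀ t ∈ C.trans, ∀ t' ∈ C.trans, t.1 = t'.1 →
    lsupp t.2.1 = lsupp t'.2.1 ∧ (t.2.1 = t'.2.1 → t = t')

def c3in1 (γ : ℕ → Q × (Option A × Option B) × List D × Q) (n : ℕ) : List A :=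
  ((List.range n).map fun i => (γ i).2.1.1).reduceOption

def c3in2 (γ : ℕ → Q × (Option A × Option B) × List D × Q) (n : ℕ) : List B :=
  ((List.range n).map fun i => (γ i).2.1.2).reduceOption

def c3out (γ : ℕ → Q × (Option A × Option B) × List D × Q) (n : ℕ) : List D :=
  ((List.range n).map fun i => (γ i).2.2.1).flatten

/-- `γ` is the accepting run of `C` on the pair `(x, y)`. -/
def Comp3.IsAccRunOn (C : Comp3 A B D Q) (γ : ℕ → Q × (Option A × Option B) × List D × Q)
    (x : ℕ → A) (y : ℕ → B) : Prop :=
  (γ 0).1 = C.init ∧ (∀ n, γ n ∈ C.trans) ∧ (∀ n, (γ n).2.2.2 = (γ (n + 1)).1) ∧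
  (∀ n, c3in1 γ n = pref x (c3in1 γ n).length) ∧
  (∀ n, c3in2 γ n = pref y (c3in2 γ n).length) ∧
  Tendsto (fun n => (c3in1 γ n).length) atTop atTop ∧
  Tendsto (fun n => (c3in2 γ n).length) atTop atTop ∧
  Tendsto (fun n => (c3out γ n).length) atTop atTop

/-- For every fixed second input `y`, the input-output map `x ↦ C(x,y)` is one-to-one. -/
def Comp3.OneToOne (C : Comp3 A B D Q) : Prop :=
  ∀ (x x' : ℕ → A) (y : ℕ → B) γ γ', C.IsAccRunOn γ x y → C.IsAccRunOn γ' x' y →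
    (∀ n, ∃ m, c3out γ n <+: c3out γ' m) → (∀ n, ∃ m, c3out γ' n <+: c3out γ m) →
    x = x'

/-- The conditional compression ratio `ρ(x/y)`: the infimum, over all conditional
compressors, of the compression ratio of `x` given the oracle `y`. -/
noncomputable def condRho [Fintype A] [Fintype B] (x : ℕ → A) (y : ℕ → B) : ℝ :=
  sInf {r : ℝ | ∃ (m d : ℕ), 2 ≤ d ∧ ∃ C : Comp3 A B (Fin d) (Fin m),
    C.TwoDet ∧ C.OneToOne ∧ ∃ γ, C.IsAccRunOn γ x y ∧
      r = Filter.liminf (fun n : ℕ =>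
        (((c3out γ n).length : ℝ) * Real.log d) /
        (((c3in1 γ n).length : ℝ) * Real.log (Fintype.card A))) atTop}

/-! ### Compressors (one-to-one 1-deterministic 2-automata) -/

/-- A `2`-automaton with one input tape (alphabet `A`) and one output tape
(alphabet `D`), with a single initial state. -/
structure Comp2 (A D Q : Type*) where
  init : Q
  trans : Set (Q × Option A × List D × Q)

def Comp2.OneDet (C : Comp2 A D Q) : Prop :=
  ∀ t ∈ C.trans, ∀ t' ∈ C.trans, t.1 = t'.1 →
    t.2.1.isSome = t'.2.1.isSome ∧ (t.2.1 = t'.2.1 → t = t')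

def c2in (γ : ℕ → Q × Option A × List D × Q) (n : ℕ) : List A :=
  ((List.range n).map fun i => (γ i).2.1).reduceOption

def c2out (γ : ℕ → Q × Option A × List D × Q) (n : ℕ) : List D :=
  ((List.range n).map fun i => (γ i).2.2.1).flatten

def Comp2.IsAccRunOn (C : Comp2 A D Q) (γ : ℕ → Q × Option A × List D × Q)
    (x : ℕ → A) : Prop :=
  (γ 0).1 = C.init ∧ (∀ n, γ n ∈ C.trans) ∧ (∀ n, (γ n).2.2.2 = (γ (n + 1)).1) ∧
  (∀ n, c2in γ n = pref x (c2in γ n).length) ∧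
  Tendsto (fun n => (c2in γ n).length) atTop atTop ∧
  Tendsto (fun n => (c2out γ n).length) atTop atTop

def Comp2.OneToOne (C : Comp2 A D Q) : Prop :=
  ∀ (x x' : ℕ → A) γ γ', C.IsAccRunOn γ x → C.IsAccRunOn γ' x' →
    (∀ n, ∃ m, c2out γ n <+: c2out γ' m) → (∀ n, ∃ m, c2out γ' n <+: c2out γ m) →
    x = x'

/-- The compression ratio `ρ(x)`. -/
noncomputable def rho [Fintype A] (x : ℕ → A) : ℝ :=
  sInf {r : ℝ | ∃ (m d : ℕ), 2 ≤ d ∧ ∃ C : Comp2 A (Fin d) (Fin m),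
    C.OneDet ∧ C.OneToOne ∧ ∃ γ, C.IsAccRunOn γ x ∧
      r = Filter.liminf (fun n : ℕ =>
        (((c2out γ n).length : ℝ) * Real.log d) /
        (((c2in γ n).length : ℝ) * Real.log (Fintype.card A))) atTop}

/-- Finite-state independence. -/
def FSIndep [Fintype A] [Fintype B] (x : ℕ → A) (y : ℕ → B) : Prop :=
  condRho x y = rho x ∧ condRho y x = rho y ∧ 0 < rho x ∧ 0 < rho y

/-! ### Oblivious selectors with two input tapes -/

/-- Types of states of a selector. -/
inductive SelTy | I | II | III

/-- An oblivious selector with first input alphabet `A` and second input alphabet `B`: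
at a state of type I it reads the next symbol of the first input and selects it, at a
state of type II it reads the next symbol of the first input without selecting it, and
at a state of type III it reads the next symbol of the second input. -/
structure Sel2 (A B : Type*) where
  states : ℕ
  init : Fin states
  ty : Fin states → SelTy
  δa : Fin states → A → Fin states
  δb : Fin states → B → Fin states

/-- Configuration (current state, symbols read from `x`, symbols read from `y`)
after `n` steps. -/
def Sel2.cfg (S : Sel2 A B) (x : ℕ → A) (y : ℕ → B) : ℕ → Fin S.states × ℕ × ℕ
  | 0 => (S.init, 0, 0)
  | n + 1 =>
    let c := S.cfg x y n
    match S.ty c.1 with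
    | SelTy.I => (S.δa c.1 (x c.2.1), c.2.1 + 1, c.2.2)
    | SelTy.II => (S.δa c.1 (x c.2.1), c.2.1 + 1, c.2.2)
    | SelTy.III => (S.δb c.1 (y c.2.2), c.2.1, c.2.2 + 1)

/-- The word selected from `x` during the first `n` steps. -/
def Sel2.outList (S : Sel2 A B) (x : ℕ → A) (y : ℕ → B) (n : ℕ) : List A :=
  (List.range n).filterMap fun i =>
    let c := S.cfg x y i
    match S.ty c.1 with
    | SelTy.I => some (x c.2.1)
    | SelTy.II => none
    | SelTy.III => none

/-! ### Oblivious one-input selection automata -/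

/-- An oblivious selection automaton with a single input tape. -/
structure Sel1 (B : Type*) where
  states : ℕ
  init : Fin states
  sel : Fin states → Bool
  δ : Fin states → B → Fin states

/-- State after reading the first `n` symbols of `y`. -/
def Sel1.st (S : Sel1 B) (y : ℕ → B) : ℕ → Fin S.states
  | 0 => S.init
  | n + 1 => S.δ (S.st y n) (y n)

/-- The word selected from the first `n` symbols of `y`. -/
def Sel1.outList (S : Sel1 B) (y : ℕ → B) (n : ℕ) : List B :=
  (List.range n).filterMap fun i => if S.sel (S.st y i) then some (y i) else none

/-! ### Shufflers -/

/-- A shuffler over the alphabet `A`: at a state of type I it reads, outputs and moves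
on the next symbol of the first input; at a state of type II it does so with the second
input. -/
structure Shuffler (A : Type*) where
  states : ℕ
  init : Fin states
  tyI : Fin states → Bool
  δ : Fin states → A → Fin states

/-- Configuration (current state, symbols read from `x`, symbols read from `y`)
after `n` steps. -/
def Shuffler.cfg (S : Shuffler A) (x y : ℕ → A) : ℕ → Fin S.states × ℕ × ℕ
  | 0 => (S.init, 0, 0)
  | n + 1 =>
    let c := S.cfg x y n
    if S.tyI c.1 then (S.δ c.1 (x c.2.1), c.2.1 + 1, c.2.2)
    else (S.δ c.1 (y c.2.2), c.2.1, c.2.2 + 1)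

/-- The output `S(x,y)` of the shuffler `S` on inputs `x` and `y`. -/
def Shuffler.out (S : Shuffler A) (x y : ℕ → A) (n : ℕ) : A :=
  let c := S.cfg x y n
  if S.tyI c.1 then x c.2.1 else y c.2.2

/-! ### Look-ahead automata -/

/-- The transitions of the look-ahead automaton `𝒜_{k,ℓ}`. -/
def lookTrans (M : TwoAut A B Q) (k ℓ : ℕ) :
    Set ((Q × List A × List B) × (Option A × Option B) × (Q × List A × List B)) :=
  {t | (∃ (q : Q) (u : List A) (a : A), u.length < k ∧
          t = ((q, u, []), (some a, none), (q, u ++ [a], ([] : List B)))) ∨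
       (∃ (q : Q) (u : List A) (v : List B) (b : B), u.length = k ∧ v.length < ℓ ∧
          t = ((q, u, v), (none, some b), (q, u, v ++ [b]))) ∨
       (∃ (q q' : Q) (a a' : A) (u' : List A) (v : List B),
          u'.length = k - 1 ∧ v.length = ℓ ∧ (q, (some a, none), q') ∈ M.trans ∧
          t = ((q, a :: u', v), (some a', none), (q', u' ++ [a'], v))) ∨
       (∃ (q q' : Q) (b b' : B) (u : List A) (v' : List B),
          u.length = k ∧ v'.length = ℓ - 1 ∧ (q, (none, some b), q') ∈ M.trans ∧
          t = ((q, u, b :: v'), (none, some b'), (q', u, v' ++ [b'])))}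

/-- The (finite) set of states of the look-ahead automaton with full buffers,
i.e. `Q × A^k × B^ℓ`. -/
noncomputable def fullFinset (Q A B : Type*) [Fintype Q] [Fintype A] [Fintype B]
    (k ℓ : ℕ) : Finset (Q × List A × List B) :=
  letI := Classical.decEq (Q × List A × List B)
  (Finset.univ : Finset (Q × (Fin k → A) × (Fin ℓ → B))).image
    fun s => (s.1, List.ofFn s.2.1, List.ofFn s.2.2)

/-! ### Counting words and measures -/

/-- The number of words of length `n` with exactly `i` occurrences of `γ`. -/
noncomputable def Ncount (γ : List A) (i n : ℕ) : ℕ :=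
  Nat.card {w : List A // w.length = n ∧ occ w γ = i}

/-- The cylinder of infinite words starting with `w`. -/
def cylinder (w : List A) : Set (ℕ → A) := {x : ℕ → A | pref x w.length = w}

/-- The set `E_S(ε,γ,n)` of pairs of inputs for which the frequency of `γ` in the first
`n` symbols of `S(x,y)` deviates from `|A|^{-|γ|}` by less than `ε`. -/
def Eset [Fintype A] (S : Shuffler A) (ε : ℝ) (γ : List A) (n : ℕ) :
    Set ((ℕ → A) × (ℕ → A)) :=
  {p : (ℕ → A) × (ℕ → A) |
    |(occ (pref (S.out p.1 p.2) n) γ : ℝ) - (n : ℝ) / (Fintype.card A : ℝ) ^ γ.length|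
      < ε * n}

/-- The set `F(ε,t,ℓ,n)`. -/
def Fset [Fintype A] (S : ℕ → Shuffler A) (ε : ℝ) (t ℓ n : ℕ) :
    Set ((ℕ → A) × (ℕ → A)) :=
  ⋂ i ∈ Finset.Icc 1 t, ⋂ r ∈ Finset.Icc 1 ℓ,
    ⋂ γ ∈ {γ : List A | γ.length = r}, Eset (S i) ε γ n

/-- `ℓ_n = (log_{|A|} n)/3`. -/
noncomputable def ellSeq (A : Type*) [Fintype A] (n : ℕ) : ℝ :=
  Real.logb (Fintype.card A) n / 3

/-- `ε_n = 2 √((log n · log_{|A|} n)/n)`. -/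
noncomputable def epsSeq (A : Type*) [Fintype A] (n : ℕ) : ℝ :=
  2 * Real.sqrt (Real.log n * Real.logb (Fintype.card A) n / n)

/-- `F_n = F(ε_n, t_n, ℓ_n, n)` with `t_n = n`. -/
noncomputable def Fn [Fintype A] (S : ℕ → Shuffler A) (n : ℕ) :
    Set ((ℕ → A) × (ℕ → A)) :=
  Fset S (epsSeq A n) n (⌊ellSeq A n⌋).toNat n

/-- `n_start`, the least `n` such that `ε_n ≥ 6/⌊n/ℓ_n⌋`. -/
noncomputable def nStart (A : Type*) [Fintype A] : ℕ :=
  sInf {m : ℕ | 0 < ⌊(m : ℝ) / ellSeq A m⌋ ∧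
    6 / ((⌊(m : ℝ) / ellSeq A m⌋ : ℤ) : ℝ) ≤ epsSeq A m}

/-- `G_n = ⋂_{j=0}^{n} F_{|A|^{n_0+j}}` where `|A|^{n_0} = n_start`. -/
noncomputable def Gn [Fintype A] (S : ℕ → Shuffler A) (n : ℕ) :
    Set ((ℕ → A) × (ℕ → A)) :=
  ⋂ j ∈ Finset.range (n + 1), Fn S (nStart A * Fintype.card A ^ j)


/-! ### The law of the output of a shuffler -/

lemma pref_succ {A : Type*} (x : ℕ → A) (n : ℕ) : pref x (n + 1) = pref x n ++ [x n] := by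
  simp [pref, List.range_succ]

lemma length_pref {A : Type*} (x : ℕ → A) (n : ℕ) : (pref x n).length = n := by
  simp [pref]

lemma mem_cylinder_append_singleton {A : Type*} (x : ℕ → A) (u : List A) (a : A) :
    x ∈ cylinder (u ++ [a]) ↔ x ∈ cylinder u ∧ x u.length = a := by
  simp only [cylinder, Set.mem_ofPred_eq, List.length_append, List.length_singleton, pref_succ]
  constructor
  · intro h
    obtain ⟨h1, h2⟩ := List.append_inj h (length_pref x _)
    exact ⟨h1, by simpa using h2⟩
  · rintro ⟨h1, rfl⟩
    rw [h1]

/-- The pairs of inputs on which the output of a shuffler starts with `w` form a product of two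
cylinders whose lengths add up to the length of `w`. -/
lemma Shuffler.exists_cylinders {A : Type*} (S : Shuffler A) (w : List A) :
    ∃ (u v : List A) (q : Fin S.states), u.length + v.length = w.length ∧
      ∀ x y, (pref (S.out x y) w.length = w ↔ x ∈ cylinder u ∧ y ∈ cylinder v) ∧
        (pref (S.out x y) w.length = w → S.cfg x y w.length = (q, u.length, v.length)) := by
  induction w using List.reverseRecOn with
  | nil => exact ⟨[], [], S.init, by simp, fun x y => by simp [pref, cylinder, Shuffler.cfg]⟩
  | append_singleton w a ih =>
    obtain ⟨u, v, q, hl, h⟩ := ih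
    have key : ∀ x y, pref (S.out x y) (w ++ [a]).length = w ++ [a] ↔
        pref (S.out x y) w.length = w ∧ S.out x y w.length = a := fun x y =>
      mem_cylinder_append_singleton (S.out x y) w a
    by_cases hq : S.tyI q = true
    · refine ⟨u ++ [a], v, S.δ q a, by simp; omega, fun x y => ?_⟩
      obtain ⟨h1, h2⟩ := h x y
      rw [key, mem_cylinder_append_singleton]
      have hout : pref (S.out x y) w.length = w → S.out x y w.length = x u.length := fun hw => by
        simp [Shuffler.out, h2 hw, hq]
      refine ⟨⟨fun ⟨hw, ha⟩ => ⟨⟨(h1.1 hw).1, (hout hw) ▸ ha⟩, (h1.1 hw).2⟩,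
        fun ⟨⟨hx, ha⟩, hy⟩ => ⟨h1.2 ⟨hx, hy⟩, (hout (h1.2 ⟨hx, hy⟩)).trans ha⟩⟩, ?_⟩
      rintro ⟨hw, ha⟩
      have ha' := (hout hw).symm.trans ha
      simp [Shuffler.cfg, h2 hw, hq, ha']
    · refine ⟨u, v ++ [a], S.δ q a, by simp; omega, fun x y => ?_⟩
      obtain ⟨h1, h2⟩ := h x y
      rw [key, mem_cylinder_append_singleton]
      have hout : pref (S.out x y) w.length = w → S.out x y w.length = y v.length := fun hw => by
        simp [Shuffler.out, h2 hw, hq]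
      refine ⟨⟨fun ⟨hw, ha⟩ => ⟨(h1.1 hw).1, (h1.1 hw).2, (hout hw) ▸ ha⟩,
        fun ⟨hx, hy, ha⟩ => ⟨h1.2 ⟨hx, hy⟩, (hout (h1.2 ⟨hx, hy⟩)).trans ha⟩⟩, ?_⟩
      rintro ⟨hw, ha⟩
      have ha' := (hout hw).symm.trans ha
      simp [Shuffler.cfg, h2 hw, hq, ha']

open MeasureTheory in
lemma Shuffler.prod_measure_pref_out {A : Type*} [Fintype A] [MeasurableSpace A]
    (μ : Measure (ℕ → A)) [SFinite μ]
    (hμ : ∀ w : List A, μ (cylinder w) = (Fintype.card A : ENNReal)⁻¹ ^ w.length)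
    (S : Shuffler A) (w : List A) :
    (μ.prod μ) {p | pref (S.out p.1 p.2) w.length = w} =
      (Fintype.card A : ENNReal)⁻¹ ^ w.length := by
  obtain ⟨u, v, q, hl, h⟩ := S.exists_cylinders w
  have : {p : (ℕ → A) × (ℕ → A) | pref (S.out p.1 p.2) w.length = w} =
      cylinder u ×ˢ cylinder v := by
    ext p
    exact (h p.1 p.2).1
  rw [this, Measure.prod_prod, hμ, hμ, ← pow_add, hl]

/-! ### Averages over the words of a given length -/

/-- The average of `F` over all words of length `n`. -/
noncomputable def wordAvg {A : Type*} [Fintype A] (n : ℕ) (F : List A → ℝ) : ℝ :=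
  ((Fintype.card A : ℝ) ^ n)⁻¹ * ∑ f : Fin n → A, F (List.ofFn f)

section WordAvg

variable {A : Type*} [Fintype A]

lemma wordAvg_mono {n : ℕ} {F G : List A → ℝ} (h : ∀ w, w.length = n → F w ≤ G w) :
    wordAvg n F ≤ wordAvg n G := by
  unfold wordAvg
  gcongr with f
  exact h _ (by simp)

lemma wordAvg_congr {n : ℕ} {F G : List A → ℝ} (h : ∀ w, w.length = n → F w = G w) :
    wordAvg n F = wordAvg n G :=
  le_antisymm (wordAvg_mono fun w hw => (h w hw).le) (wordAvg_mono fun w hw => (h w hw).ge)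

lemma wordAvg_add (n : ℕ) (F G : List A → ℝ) :
    wordAvg n (fun w => F w + G w) = wordAvg n F + wordAvg n G := by
  simp [wordAvg, Finset.sum_add_distrib, mul_add]

lemma wordAvg_sum {ι : Type*} (s : Finset ι) (n : ℕ) (F : ι → List A → ℝ) :
    wordAvg n (fun w => ∑ i ∈ s, F i w) = ∑ i ∈ s, wordAvg n (F i) := by
  simp only [wordAvg]
  rw [Finset.sum_comm, Finset.mul_sum]

lemma wordAvg_const_mul (n : ℕ) (c : ℝ) (F : List A → ℝ) :
    wordAvg n (fun w => c * F w) = c * wordAvg n F := by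
  simp only [wordAvg, ← Finset.mul_sum]
  ring

lemma wordAvg_const [Nonempty A] (n : ℕ) (c : ℝ) : wordAvg n (fun _ : List A => c) = c := by
  simp [wordAvg]

lemma wordAvg_zero (F : List A → ℝ) : wordAvg 0 F = F [] := by
  simp [wordAvg]

lemma wordAvg_succ (n : ℕ) (F : List A → ℝ) :
    wordAvg (n + 1) F =
      (Fintype.card A : ℝ)⁻¹ * ∑ a : A, wordAvg n (fun w => F (a :: w)) := by
  simp only [wordAvg, ← Finset.mul_sum]
  rw [← (Fin.consEquiv fun _ : Fin (n + 1) => A).sum_comp, Fintype.sum_prod_type]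
  simp only [Fin.consEquiv, Equiv.coe_fn_mk, List.ofFn_succ, Fin.cons_zero, Fin.cons_succ]
  rw [pow_succ, mul_inv]
  ring

lemma wordAvg_append (m n : ℕ) (F : List A → ℝ) :
    wordAvg (m + n) F = wordAvg m fun u => wordAvg n fun v => F (u ++ v) := by
  induction m generalizing F with
  | zero => simp [wordAvg_zero]
  | succ m ih =>
    rw [Nat.add_right_comm, wordAvg_succ, wordAvg_succ]
    simp only [ih, List.cons_append]

open Classical in
lemma wordAvg_eq_ite (γ : List A) :
    wordAvg γ.length (fun w => if w = γ then (1 : ℝ) else 0) =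
      ((Fintype.card A : ℝ) ^ γ.length)⁻¹ := by
  have h : ∀ f : Fin γ.length → A, List.ofFn f = γ ↔ f = γ.get := fun f => by
    rw [← List.ofFn_inj, List.ofFn_get]
  simp [wordAvg, h]

/-- Disjoint aligned blocks of a uniform word are independent. -/
lemma wordAvg_prod_blocks [Nonempty A] (r : ℕ) (h : List A → ℝ) (m j s : ℕ) :
    wordAvg (j + (m * r + s))
        (fun w => ∏ i ∈ Finset.range m, h ((w.drop (j + i * r)).take r)) =
      wordAvg r h ^ m := by
  have h0 : ∀ m, wordAvg (m * r + s)
      (fun w => ∏ i ∈ Finset.range m, h ((w.drop (i * r)).take r)) = wordAvg r h ^ m := by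
    intro m
    induction m with
    | zero => simp [wordAvg_const]
    | succ m ih =>
      rw [show (m + 1) * r + s = r + (m * r + s) by ring, wordAvg_append, pow_succ,
        mul_comm, ← ih, mul_comm, ← wordAvg_const_mul]
      refine wordAvg_congr fun u hu => ?_
      rw [mul_comm _ (h u), ← wordAvg_const_mul]
      refine wordAvg_congr fun v _ => ?_
      rw [Finset.prod_range_succ', mul_comm]
      congr 1
      · simp [← hu]
      · refine Finset.prod_congr rfl fun i _ => ?_
        rw [show (i + 1) * r = u.length + i * r by rw [hu]; ring, List.drop_length_add_append]
  rw [wordAvg_append, ← h0 m]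
  conv_rhs => rw [← wordAvg_const (A := A) j (wordAvg (m * r + s) _)]
  refine wordAvg_congr fun u hu => wordAvg_congr fun v _ => ?_
  refine Finset.prod_congr rfl fun i _ => ?_
  rw [← hu, List.drop_length_add_append]

open MeasureTheory in
open Classical in
lemma Shuffler.prod_measure_le_wordAvg [MeasurableSpace A] [Nonempty A]
    (μ : Measure (ℕ → A)) [SFinite μ]
    (hμ : ∀ w : List A, μ (cylinder w) = (Fintype.card A : ENNReal)⁻¹ ^ w.length)
    (S : Shuffler A) (n : ℕ) (P : List A → Prop) :
    (μ.prod μ) {p | P (pref (S.out p.1 p.2) n)} ≤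
      ENNReal.ofReal (wordAvg n fun w => if P w then 1 else 0) := by
  have hsub : {p : (ℕ → A) × (ℕ → A) | P (pref (S.out p.1 p.2) n)} ⊆
      ⋃ f ∈ Finset.univ.filter (fun f : Fin n → A => P (List.ofFn f)),
        {p | pref (S.out p.1 p.2) n = List.ofFn f} := by
    intro p hp
    have e : List.ofFn (fun i : Fin n => S.out p.1 p.2 i) = pref (S.out p.1 p.2) n := by
      apply List.ext_getElem <;> simp [pref]
    simp only [Finset.mem_filter, Finset.mem_univ, true_and, Set.mem_iUnion, Set.mem_ofPred_eq]
    exact ⟨_, by rw [e]; exact hp, e.symm⟩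
  refine (measure_mono hsub).trans ((measure_biUnion_finset_le _ _).trans ?_)
  have hw : ∀ f : Fin n → A, (μ.prod μ) {p | pref (S.out p.1 p.2) n = List.ofFn f} =
      ENNReal.ofReal (((Fintype.card A : ℝ) ^ n)⁻¹) := by
    intro f
    have := S.prod_measure_pref_out μ hμ (List.ofFn f)
    rw [List.length_ofFn] at this
    have hc : (0 : ℝ) < Fintype.card A := by exact_mod_cast Fintype.card_pos
    rw [this, ← inv_pow, ENNReal.ofReal_pow (by positivity), ENNReal.ofReal_inv_of_pos hc,
      ENNReal.ofReal_natCast]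
  simp only [hw, Finset.sum_const, nsmul_eq_mul]
  rw [wordAvg, Finset.sum_boole, ← ENNReal.ofReal_natCast,
    ← ENNReal.ofReal_mul (by positivity), mul_comm]

end WordAvg

/-! ### Exponential moments of the number of occurrences -/

open Classical in
/-- Occurrences of `γ`, sorted by their starting position modulo `γ.length`. -/
lemma occ_eq_sum {A : Type*} (w γ : List A) (hγ : 0 < γ.length) (hw : γ.length ≤ w.length) :
    occ w γ = ∑ j ∈ Finset.range γ.length, ∑ i ∈ Finset.range ((w.length - j) / γ.length),
      if (w.drop (j + i * γ.length)).take γ.length = γ then 1 else 0 := by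
  set r := γ.length with hr
  set F := (Finset.range (w.length + 1)).filter
    (fun i => i + r ≤ w.length ∧ (w.drop i).take r = γ) with hF
  have h1 : occ w γ = F.card := by
    rw [occ, ← hr]
    have : {i : ℕ | i + r ≤ w.length ∧ (w.drop i).take r = γ} = (F : Set ℕ) := by
      ext i
      simp only [hF, Finset.coe_filter, Finset.mem_range, Set.mem_ofPred_eq]
      constructor
      · rintro ⟨h, h'⟩
        exact ⟨by omega, h, h'⟩
      · exact fun h => h.2
    rw [this]
    simp
  rw [h1, Finset.card_eq_sum_card_fiberwise (f := fun i => i % r) (t := Finset.range r)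
    (fun i _ => by simpa using Nat.mod_lt _ hγ)]
  refine Finset.sum_congr rfl fun j hj => ?_
  rw [Finset.mem_range] at hj
  rw [Finset.sum_boole, Nat.cast_id]
  symm
  refine Finset.card_nbij' (fun i => j + i * r) (fun i => i / r) ?_ ?_ ?_ ?_
  · intro i hi
    simp only [Finset.coe_filter, Finset.mem_range, Set.mem_ofPred_eq] at hi
    have h2 : (i + 1) * r ≤ w.length - j := (Nat.le_div_iff_mul_le hγ).1 hi.1
    rw [add_mul, one_mul] at h2
    simp only [hF, Finset.coe_filter, Finset.mem_filter, Finset.mem_range, Set.mem_ofPred_eq]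
    refine ⟨⟨by omega, by omega, hi.2⟩, ?_⟩
    rw [Nat.add_mul_mod_self_right, Nat.mod_eq_of_lt hj]
  · intro i hi
    simp only [hF, Finset.coe_filter, Finset.mem_filter, Finset.mem_range,
      Set.mem_ofPred_eq] at hi
    obtain ⟨⟨_, h2, h3⟩, h4⟩ := hi
    have h5 : j + i / r * r = i := by rw [← h4, mul_comm]; exact Nat.mod_add_div i r
    simp only [Finset.coe_filter, Finset.mem_range, Set.mem_ofPred_eq, h5]
    refine ⟨?_, h3⟩
    apply (Nat.le_div_iff_mul_le hγ).2
    rw [Nat.succ_eq_add_one, add_mul, one_mul]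
    omega
  · intro i _
    simp only
    rw [Nat.add_mul_div_right _ _ hγ, Nat.div_eq_of_lt hj, zero_add]
  · intro i hi
    simp only [Finset.coe_filter, Set.mem_ofPred_eq] at hi
    simp only
    rw [← hi.2, mul_comm]
    exact Nat.mod_add_div i r

lemma exp_sum_div_le {r : ℕ} (hr : 0 < r) (X : ℕ → ℝ) (θ : ℝ) :
    Real.exp (θ / r * ∑ j ∈ Finset.range r, X j) ≤
      ∑ j ∈ Finset.range r, (r : ℝ)⁻¹ * Real.exp (θ * X j) := by
  have hr' : (0 : ℝ) < r := by exact_mod_cast hr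
  have := convexOn_exp.map_sum_le (t := Finset.range r) (w := fun _ => (r : ℝ)⁻¹)
    (p := fun j => θ * X j) (fun _ _ => by positivity) (by simp [hr'.ne']) (fun _ _ => trivial)
  simp only [smul_eq_mul] at this
  refine le_of_eq_of_le ?_ this
  rw [Finset.mul_sum]
  exact congrArg _ (Finset.sum_congr rfl fun j _ => by ring)

/-- Bound for the moment generating function of the number of occurrences, where `c` bounds the
exponents coming from each residue class of starting positions. -/
lemma wordAvg_exp_occ_le {A : Type*} [Fintype A] [Nonempty A] (γ : List A) (n : ℕ)
    (hγ : 0 < γ.length) (hn : γ.length ≤ n) (θ c : ℝ)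
    (hc : ∀ j < γ.length, ((n - j) / γ.length : ℕ) *
      (((Fintype.card A : ℝ) ^ γ.length)⁻¹ * (Real.exp θ - 1)) ≤ c) :
    wordAvg n (fun w : List A => Real.exp (θ / γ.length * occ w γ)) ≤ Real.exp c := by
  classical
  set r := γ.length with hr
  set h : List A → ℝ := fun u => Real.exp (θ * if u = γ then 1 else 0) with hh
  have hh' : wordAvg r h = 1 + ((Fintype.card A : ℝ) ^ r)⁻¹ * (Real.exp θ - 1) := by
    rw [hr, ← wordAvg_eq_ite γ, mul_comm, ← wordAvg_const_mul]
    conv_rhs => enter [1]; rw [← wordAvg_const (A := A) γ.length 1]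
    rw [← wordAvg_add]
    refine wordAvg_congr fun w _ => ?_
    by_cases hw : w = γ <;> simp [hh, hw]
  have h1 : wordAvg n (fun w : List A => Real.exp (θ / r * occ w γ)) ≤
      wordAvg n (fun w => ∑ j ∈ Finset.range r, (r : ℝ)⁻¹ *
        ∏ i ∈ Finset.range ((n - j) / r), h ((w.drop (j + i * r)).take r)) := by
    refine wordAvg_mono fun w hw => ?_
    rw [occ_eq_sum w γ hγ (hw ▸ hn), hw, ← hr]
    push_cast
    refine (exp_sum_div_le hγ _ θ).trans_eq (Finset.sum_congr rfl fun j _ => ?_)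
    rw [Finset.mul_sum, Real.exp_sum]
  refine h1.trans ?_
  rw [wordAvg_sum]
  have h2 : ∀ j ∈ Finset.range r, wordAvg n (fun w => (r : ℝ)⁻¹ *
      ∏ i ∈ Finset.range ((n - j) / r), h ((w.drop (j + i * r)).take r)) ≤
        (r : ℝ)⁻¹ * Real.exp c := by
    intro j hj
    rw [Finset.mem_range] at hj
    rw [wordAvg_const_mul]
    gcongr
    have e : n = j + ((n - j) / r * r + (n - j) % r) := by
      rw [mul_comm, Nat.div_add_mod]; omega
    conv_lhs => enter [1]; rw [e]
    rw [wordAvg_prod_blocks]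
    refine le_trans ?_ (Real.exp_le_exp.2 (hc j hj))
    rw [Real.exp_nat_mul, hh']
    gcongr
    · rw [← hh', ← wordAvg_const (A := A) r 0]
      exact wordAvg_mono fun w _ => (Real.exp_pos _).le
    · rw [add_comm]
      exact Real.add_one_le_exp _
  refine (Finset.sum_le_sum h2).trans_eq ?_
  have hr' : (r : ℝ) ≠ 0 := by exact_mod_cast hγ.ne'
  simp [hr']

/-- Large deviation bound for the number of occurrences of `γ` in a uniform word. -/
lemma wordAvg_deviation_lt {A : Type*} [Fintype A] (hA : 2 ≤ Fintype.card A)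
    (γ : List A) (n : ℕ) (hγ : 0 < γ.length) (hn : γ.length ≤ n) (ε : ℝ)
    (hε₁ : 6 / ((n / γ.length : ℕ) : ℝ) ≤ ε)
    (hε₂ : ε ≤ 1 / (Fintype.card A : ℝ) ^ γ.length) (P : List A → Prop) [DecidablePred P]
    (hP : ∀ w, P w → ε * n ≤ |(occ w γ : ℝ) - n / (Fintype.card A : ℝ) ^ γ.length|) :
    wordAvg n (fun w => if P w then (1 : ℝ) else 0) <
      2 * Real.exp (-((Fintype.card A : ℝ) ^ γ.length * ε ^ 2 * n / (6 * γ.length))) := by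
  have : Nonempty A := Fintype.card_pos_iff.1 (by omega)
  have hK2 : (2 : ℝ) ≤ (Fintype.card A : ℝ) ^ γ.length := by
    calc (2 : ℝ) ≤ Fintype.card A := by exact_mod_cast hA
      _ ≤ _ := le_self_pow₀ (by exact_mod_cast (by omega : 1 ≤ Fintype.card A)) hγ.ne'
  have hmgf := wordAvg_exp_occ_le γ n hγ hn
  set K : ℝ := (Fintype.card A : ℝ) ^ γ.length with hK
  set r := γ.length with hr
  have hr0 : (0 : ℝ) < r := by exact_mod_cast hγ
  have hK0 : 0 < K := by linarith
  set t : ℝ := n / r with ht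
  have hq : (0 : ℝ) < ((n / r : ℕ) : ℝ) := by exact_mod_cast Nat.div_pos hn hγ
  have hqt : ((n / r : ℕ) : ℝ) ≤ t := Nat.cast_div_le
  have ht0 : 0 < t := by linarith
  have hε0 : 0 < ε := lt_of_lt_of_le (by positivity) hε₁
  have hεt : 6 ≤ ε * t := by
    rw [div_le_iff₀ hq] at hε₁
    exact hε₁.trans (by gcongr)
  have hKε : K * ε ≤ 1 := by
    rwa [le_div_iff₀ hK0, mul_comm] at hε₂
  have hm1 : ∀ j, (((n - j) / r : ℕ) : ℝ) ≤ t := fun j =>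
    le_trans (by exact_mod_cast Nat.div_le_div_right (Nat.sub_le n j)) hqt
  have hm2 : ∀ j < r, t - 2 ≤ (((n - j) / r : ℕ) : ℝ) := by
    intro j hj
    have h1 := Nat.div_add_mod (n - j) r
    have h2 := Nat.mod_lt (n - j) hγ
    have h3 : n ≤ r * ((n - j) / r) + 2 * r := by omega
    have h4 : (n : ℝ) ≤ r * (((n - j) / r : ℕ) : ℝ) + 2 * r := by exact_mod_cast h3
    rw [sub_le_iff_le_add, ht, div_le_iff₀ hr0]
    linarith
  set θ : ℝ := K * ε / 2 with hθ
  have hθ0 : 0 < θ := by positivity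
  have hθ1 : θ ≤ 1 / 2 := by linarith
  have hKθ : K⁻¹ * θ = ε / 2 := by rw [hθ]; field_simp
  have e1 : Real.exp θ - 1 ≤ θ + θ ^ 2 := by
    have := (abs_le.1 (Real.abs_exp_sub_one_sub_id_le (x := θ)
      (by rw [abs_of_pos hθ0]; linarith))).2
    linarith
  have e2 : Real.exp (-θ) - 1 ≤ -θ + θ ^ 2 := by
    have := (abs_le.1 (Real.abs_exp_sub_one_sub_id_le (x := -θ)
      (by rw [abs_neg, abs_of_pos hθ0]; linarith))).2
    linarith
  have hup := hmgf θ (t * (K⁻¹ * (θ + θ ^ 2))) fun j _ => by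
    have : 0 ≤ Real.exp θ - 1 := by linarith [Real.add_one_le_exp θ]
    gcongr
    exact hm1 j
  have hlow := hmgf (-θ) (t * (K⁻¹ * (-θ + θ ^ 2)) + ε) fun j hj => by
    calc (((n - j) / r : ℕ) : ℝ) * (K⁻¹ * (Real.exp (-θ) - 1))
        ≤ (((n - j) / r : ℕ) : ℝ) * (K⁻¹ * (-θ + θ ^ 2)) := by gcongr
      _ ≤ (t - 2) * (K⁻¹ * (-θ + θ ^ 2)) := by
          apply mul_le_mul_of_nonpos_right (hm2 j hj)
          apply mul_nonpos_of_nonneg_of_nonpos (by positivity)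
          nlinarith
      _ ≤ _ := by
          have : 0 ≤ K⁻¹ * θ ^ 2 := by positivity
          nlinarith
  have hnt : (n : ℝ) = t * r := by rw [ht]; field_simp
  have hpt : wordAvg n (fun w => if P w then (1 : ℝ) else 0) ≤
      Real.exp (-(θ * (t / K + ε * t))) *
        wordAvg n (fun w => Real.exp (θ / r * occ w γ)) +
      Real.exp (θ * (t / K - ε * t)) *
        wordAvg n (fun w => Real.exp (-θ / r * occ w γ)) := by
    rw [← wordAvg_const_mul, ← wordAvg_const_mul, ← wordAvg_add]
    refine wordAvg_mono fun w _ => ?_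
    rw [← Real.exp_add, ← Real.exp_add]
    split_ifs with hw
    · have hd := hP w hw
      rw [hnt] at hd
      rcases le_abs.1 hd with h | h
      · refine le_add_of_le_of_nonneg (Real.one_le_exp ?_) (Real.exp_pos _).le
        have : -(θ * (t / K + ε * t)) + θ / r * occ w γ =
            θ / r * ((occ w γ - t * r / K) - ε * (t * r)) := by field_simp; ring
        rw [this]
        exact mul_nonneg (by positivity) (by linarith)
      · refine le_add_of_nonneg_of_le (Real.exp_pos _).le (Real.one_le_exp ?_)
        have : θ * (t / K - ε * t) + -θ / r * occ w γ =
            θ / r * (-(occ w γ - t * r / K) - ε * (t * r)) := by field_simp; ring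
        rw [this]
        exact mul_nonneg (by positivity) (by linarith)
    · positivity
  have hgoal : K * ε ^ 2 * n / (6 * r) = K * ε ^ 2 * t / 6 := by rw [hnt]; field_simp
  have hpos : 0 < K * ε ^ 2 * t := by positivity
  rw [hgoal, two_mul]
  refine hpt.trans_lt (add_lt_add_of_lt_of_le ?_ ?_)
  · refine (mul_le_mul_of_nonneg_left hup (Real.exp_pos _).le).trans_lt ?_
    rw [← Real.exp_add, Real.exp_lt_exp]
    have : -(θ * (t / K + ε * t)) + t * (K⁻¹ * (θ + θ ^ 2)) = -(K * ε ^ 2 * t / 4) := by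
      rw [hθ]; field_simp; ring
    linarith
  · refine (mul_le_mul_of_nonneg_left hlow (Real.exp_pos _).le).trans ?_
    rw [← Real.exp_add, Real.exp_le_exp]
    have : θ * (t / K - ε * t) + (t * (K⁻¹ * (-θ + θ ^ 2)) + ε) =
        -(K * ε ^ 2 * t / 4) + ε := by
      rw [hθ]; field_simp; ring
    have : 12 * ε ≤ K * ε ^ 2 * t := by
      calc 12 * ε = 2 * ε * 6 := by ring
        _ ≤ K * ε * (ε * t) := by gcongr
        _ = _ := by ring
    linarith

open MeasureTheory in
/-- Measure lower bound for the set `E_S(ε,γ,n)`. -/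
theorem Eset_measure_bound {A : Type*} [Fintype A] [MeasurableSpace A]
    (hA : 2 ≤ Fintype.card A)
    (μ : Measure (ℕ → A)) [IsProbabilityMeasure μ]
    (hμ : ∀ w : List A, μ (cylinder w) = (Fintype.card A : ENNReal)⁻¹ ^ w.length)
    (S : Shuffler A) (n r : ℕ) (hn : 0 < n) (hr : 0 < r)
    (ε : ℝ) (hε₁ : 6 / ((n / r : ℕ) : ℝ) ≤ ε)
    (hε₂ : ε ≤ 1 / (Fintype.card A : ℝ) ^ r)
    (γ : List A) (hγ : γ.length = r) :
    1 - 2 * (Fintype.card A : ℝ) ^ (2 * r - 2) * r *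
        Real.exp (-((Fintype.card A : ℝ) ^ r * ε ^ 2 * n / (6 * r)))
      < ((μ.prod μ) (Eset S ε γ n)).toReal := by
  classical
  have : Nonempty A := Fintype.card_pos_iff.1 (by omega)
  subst hγ
  set r := γ.length with hr'
  have hb1 : (1 : ℝ) ≤ Fintype.card A := by exact_mod_cast (by omega : 1 ≤ Fintype.card A)
  have hr1 : (1 : ℝ) ≤ r := by exact_mod_cast hr
  have hB : 1 ≤ (Fintype.card A : ℝ) ^ (2 * r - 2) * r :=
    one_le_mul_of_one_le_of_one_le (one_le_pow₀ hb1) hr1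
  rcases lt_or_ge n r with hnr | hnr
  · have hε0 : 0 ≤ ε := le_trans (by positivity) hε₁
    have hK1 : (1 : ℝ) ≤ (Fintype.card A : ℝ) ^ r := one_le_pow₀ hb1
    have hKε : (Fintype.card A : ℝ) ^ r * ε ≤ 1 := by
      rwa [le_div_iff₀ (by linarith), mul_comm] at hε₂
    have hε1 : ε ≤ 1 := by nlinarith
    have hx : (Fintype.card A : ℝ) ^ r * ε ^ 2 * n / (6 * r) ≤ 1 / 6 := by
      rw [div_le_div_iff₀ (by positivity) (by norm_num)]
      have h1 : (Fintype.card A : ℝ) ^ r * ε ^ 2 ≤ 1 := by nlinarith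
      have h2 : (n : ℝ) ≤ r := by exact_mod_cast hnr.le
      nlinarith [mul_le_mul h1 h2 (by positivity) zero_le_one]
    have he := Real.add_one_le_exp (-((Fintype.card A : ℝ) ^ r * ε ^ 2 * n / (6 * r)))
    refine lt_of_lt_of_le ?_ ENNReal.toReal_nonneg
    nlinarith
  · set P : List A → Prop := fun w =>
      ε * n ≤ |(occ w γ : ℝ) - n / (Fintype.card A : ℝ) ^ γ.length| with hP
    have hdev := wordAvg_deviation_lt hA γ n hr hnr ε hε₁ hε₂ P fun w hw => hw
    have hmeas := S.prod_measure_le_wordAvg μ hμ n P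
    have hcompl : (Eset S ε γ n)ᶜ = {p | P (pref (S.out p.1 p.2) n)} := by
      ext p
      simp [Eset, hP]
    have hone : (1 : ENNReal) ≤ (μ.prod μ) (Eset S ε γ n) + (μ.prod μ) (Eset S ε γ n)ᶜ := by
      rw [← measure_univ (μ := μ.prod μ), ← Set.union_compl_self (Eset S ε γ n)]
      exact measure_union_le _ _
    have havg : 0 ≤ wordAvg n (fun w => if P w then (1 : ℝ) else 0) :=
      (wordAvg_const (A := A) n 0).symm.trans_le
        (wordAvg_mono fun w _ => by split_ifs <;> norm_num)
    have hreal := ENNReal.toReal_mono (by finiteness)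
      (hone.trans (add_le_add_right (hcompl ▸ hmeas) _))
    rw [ENNReal.toReal_add (by finiteness) (by finiteness), ENNReal.toReal_ofReal havg,
      ENNReal.toReal_one] at hreal
    have he := Real.exp_pos (-((Fintype.card A : ℝ) ^ r * ε ^ 2 * n / (6 * r)))
    nlinarith [mul_le_mul_of_nonneg_right hB he.le]

end FSI
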